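/- Up to unimodular equivalence (affine lattice isomorphism of ℤ^d) there are only finitely many d-dimensional lattice polytopes with exactly one interior lattice point; in particular there are finitely many reflexive polytopes in each dimension. -/

import Mathlib

open Set

noncomputable section

/-- Standard dot product on `ℝ^d`. -/
def dotp {d : ℕ} (v x : Fin d → ℝ) : ℝ := ∑ i, v i * x i

/-- Polar dual `P^∨ = {v | ⟨v,x⟩ ≤ 1 ∀ x ∈ P}`. -/
def polarDual {d : ℕ} (P : Set (Fin d → ℝ)) : Set (Fin d → ℝ) :=
  {v | ∀ x ∈ P, dotp v x ≤ 1}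

/-- A point of `ℝ^d` lying in the lattice `ℤ^d`. -/
def IsLatticePt {d : ℕ} (x : Fin d → ℝ) : Prop := ∀ i, ∃ n : ℤ, x i = (n : ℝ)

/-- A polytope: convex hull of finitely many points. -/
def IsPolytope {d : ℕ} (P : Set (Fin d → ℝ)) : Prop :=
  ∃ V : Finset (Fin d → ℝ), P = convexHull ℝ (V : Set (Fin d → ℝ))

/-- A lattice polytope: convex hull of finitely many lattice points. -/
def IsLatticePolytope {d : ℕ} (P : Set (Fin d → ℝ)) : Prop :=
  ∃ V : Finset (Fin d → ℝ), (∀ x ∈ V, IsLatticePt x) ∧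
    P = convexHull ℝ (V : Set (Fin d → ℝ))

/-- `F` is a face of `P`: the subset of `P` where some linear functional bounded
above on `P` attains its maximum. -/
def IsFace {d : ℕ} (P F : Set (Fin d → ℝ)) : Prop :=
  ∃ (c : Fin d → ℝ) (b : ℝ), (∀ x ∈ P, dotp c x ≤ b) ∧ F = {x ∈ P | dotp c x = b}

/-- Dimension of a subset of `ℝ^d` (dimension of its affine hull). -/
def fdim {d : ℕ} (F : Set (Fin d → ℝ)) : ℕ := Module.finrank ℝ (vectorSpan ℝ F)

/-- A facet is a face of dimension `d - 1`. -/
def IsFacet {d : ℕ} (P F : Set (Fin d → ℝ)) : Prop :=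
  IsFace P F ∧ fdim F = d - 1

/-- The lattice `ℤ^d` sitting inside `ℝ^d`, as a `ℤ`-submodule. -/
def latticeSubmodule (d : ℕ) : Submodule ℤ (Fin d → ℝ) :=
  Submodule.span ℤ {x : Fin d → ℝ | IsLatticePt x}

/-- A set of vectors forms a `ℤ`-basis of the lattice `ℤ^d`:
it is `ℝ`-linearly independent and `ℤ`-spans the lattice. -/
def IsLatticeBasisSet {d : ℕ} (S : Set (Fin d → ℝ)) : Prop :=
  LinearIndependent ℝ (fun v : S => (v : Fin d → ℝ)) ∧
    Submodule.span ℤ S = latticeSubmodule d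

/-- A smooth Fano polytope: full-dimensional lattice polytope with `0` in its
interior, such that the vertex set of every facet is a `ℤ`-basis of `ℤ^d`. -/
def IsSmoothFano {d : ℕ} (P : Set (Fin d → ℝ)) : Prop :=
  IsLatticePolytope P ∧ (0 : Fin d → ℝ) ∈ interior P ∧ fdim P = d ∧
    ∀ F, IsFacet P F → IsLatticeBasisSet (Set.extremePoints ℝ F)

/-- A reflexive polytope: full-dimensional lattice polytope with `0` in its
interior whose polar dual is again a lattice polytope. -/
def IsReflexive {d : ℕ} (P : Set (Fin d → ℝ)) : Prop :=
  IsLatticePolytope P ∧ fdim P = d ∧ (0 : Fin d → ℝ) ∈ interior P ∧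
    IsLatticePolytope (polarDual P)

/-- Free sum `P ⊕ Q = conv((P × {0}) ∪ ({0} × Q))`. -/
def freeSum {a b : ℕ} (P : Set (Fin a → ℝ)) (Q : Set (Fin b → ℝ)) :
    Set (Fin (a + b) → ℝ) :=
  convexHull ℝ ((fun v => Fin.append v (0 : Fin b → ℝ)) '' P ∪
    (fun w => Fin.append (0 : Fin a → ℝ) w) '' Q)

/-- Product `P × Q = {(x,y) | x ∈ P, y ∈ Q}`. -/
def prodPoly {a b : ℕ} (P : Set (Fin a → ℝ)) (Q : Set (Fin b → ℝ)) :
    Set (Fin (a + b) → ℝ) :=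
  {z | ∃ x ∈ P, ∃ y ∈ Q, z = Fin.append x y}

/-- Lattice equivalence: `Q = A · P` with `A ∈ GL_d(ℤ)`. -/
def LatticeEquiv {d : ℕ} (P Q : Set (Fin d → ℝ)) : Prop :=
  ∃ A : Matrix (Fin d) (Fin d) ℤ, IsUnit A.det ∧
    Q = (fun x => (A.map (Int.cast : ℤ → ℝ)).mulVec x) '' P

/-- Affine unimodular equivalence: `Q = A · P + t` with `A ∈ GL_d(ℤ)`, `t ∈ ℤ^d`. -/
def AffineLatticeEquiv {d : ℕ} (P Q : Set (Fin d → ℝ)) : Prop :=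
  ∃ (A : Matrix (Fin d) (Fin d) ℤ) (t : Fin d → ℤ), IsUnit A.det ∧
    Q = (fun x => (A.map (Int.cast : ℤ → ℝ)).mulVec x + fun i => (t i : ℝ)) '' P

/-- Combinatorial isomorphism: an inclusion-preserving bijection of face lattices. -/
def CombIso {n : ℕ} (P Q : Set (Fin n → ℝ)) : Prop :=
  ∃ φ : {F : Set (Fin n → ℝ) // IsFace P F} ≃ {F : Set (Fin n → ℝ) // IsFace Q F},
    ∀ F G, F.1 ⊆ G.1 ↔ (φ F).1 ⊆ (φ G).1


/-- Conic Caratheodory. -/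
lemma conic_carath {d : ℕ} : ∀ (n : ℕ) (V : Finset (Fin d → ℝ)) (c : (Fin d → ℝ) → ℝ),
    V.card = n → (∀ u ∈ V, 0 ≤ c u) →
    ∃ U ⊆ V, ∃ c' : (Fin d → ℝ) → ℝ, (∀ u ∈ U, 0 < c' u) ∧
      ∑ u ∈ U, c' u • u = ∑ u ∈ V, c u • u ∧
      ∀ g : (Fin d → ℝ) → ℝ, ∑ u ∈ U, g u • u = 0 → ∀ u ∈ U, g u = 0 := by
  intro n
  induction n with
  | zero =>
    intro V c hV hc
    rw [Finset.card_eq_zero] at hV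
    subst hV
    exact ⟨∅, by simp, c, by simp, by simp, by simp⟩
  | succ n ih =>
    intro V c hV hc
    -- reduction when some coefficient vanishes
    have red : ∀ c₁ : (Fin d → ℝ) → ℝ, (∀ u ∈ V, 0 ≤ c₁ u) →
        ∑ u ∈ V, c₁ u • u = ∑ u ∈ V, c u • u → (∃ u ∈ V, c₁ u = 0) →
        ∃ U ⊆ V, ∃ c' : (Fin d → ℝ) → ℝ, (∀ u ∈ U, 0 < c' u) ∧
          ∑ u ∈ U, c' u • u = ∑ u ∈ V, c u • u ∧
          ∀ g : (Fin d → ℝ) → ℝ, ∑ u ∈ U, g u • u = 0 → ∀ u ∈ U, g u = 0 := by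
      rintro c₁ h1 h2 ⟨u₁, hu₁, h3⟩
      obtain ⟨U, hU, c', p1, p2, p3⟩ := ih (V.erase u₁) c₁
        (by rw [Finset.card_erase_of_mem hu₁, hV]; rfl)
        (fun u hu => h1 u (Finset.mem_of_mem_erase hu))
      refine ⟨U, hU.trans (Finset.erase_subset _ _), c', p1, ?_, p3⟩
      rw [p2, ← h2, ← Finset.add_sum_erase V _ hu₁, h3, zero_smul, zero_add]
    by_cases hz : ∃ u ∈ V, c u = 0
    · exact red c hc rfl hz
    push Not at hz
    by_cases hi : ∀ g : (Fin d → ℝ) → ℝ, ∑ u ∈ V, g u • u = 0 → ∀ u ∈ V, g u = 0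
    · exact ⟨V, subset_rfl, c, fun u hu => lt_of_le_of_ne (hc u hu) (hz u hu).symm, rfl, hi⟩
    push Not at hi
    have hi' : ∃ g : (Fin d → ℝ) → ℝ, ∑ u ∈ V, g u • u = 0 ∧ ∃ u ∈ V, 0 < g u := by
      obtain ⟨g, hg, u, hu, hgu⟩ := hi
      rcases lt_or_gt_of_ne hgu with h | h
      · refine ⟨fun u => - g u, ?_, u, hu, by simpa using h⟩
        simp [hg]
      · exact ⟨g, hg, u, hu, h⟩
    obtain ⟨g, hg, u₀, hu₀, hgu₀⟩ := hi'
    obtain ⟨u₁, hu₁, hmin⟩ := Finset.exists_min_image (V.filter fun u => 0 < g u)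
      (fun u => c u / g u) ⟨u₀, by simp [hu₀, hgu₀]⟩
    rw [Finset.mem_filter] at hu₁
    refine red (fun u => c u - c u₁ / g u₁ * g u) ?_ ?_ ⟨u₁, hu₁.1, ?_⟩
    · intro u hu
      rcases lt_or_ge 0 (g u) with h | h
      · have := hmin u (by simp [hu, h])
        rw [le_div_iff₀ h] at this
        linarith
      · have h1 : 0 ≤ c u₁ / g u₁ := div_nonneg (hc _ hu₁.1) hu₁.2.le
        have h2 := hc u hu
        nlinarith
    · simp only [sub_smul, mul_smul, Finset.sum_sub_distrib]
      rw [← Finset.smul_sum, hg]; simp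
    · have := hu₁.2.ne'
      field_simp
      ring

/-- Simultaneous Dirichlet approximation. -/
lemma dirichlet_sim (n : ℕ) (ε : ℝ) (hε : 0 < ε) : ∃ T : ℕ, 1 ≤ T ∧
    ∀ (ι : Type) [Fintype ι], Fintype.card ι ≤ n → ∀ x : ι → ℝ,
      ∃ t : ℕ, 1 ≤ t ∧ t ≤ T ∧ ∃ m : ι → ℤ, ∀ i, |t * x i - m i| < ε := by
  obtain ⟨N, hN⟩ := exists_nat_gt (1 / ε)
  have hNpos : (0 : ℝ) < N := lt_trans (by positivity) hN
  have hN0 : 0 < N := by exact_mod_cast hNpos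
  refine ⟨N ^ n, Nat.one_le_pow _ _ hN0, ?_⟩
  intro ι _ hι x
  classical
  let f : ℕ → ι → ℤ := fun k i => ⌊N * Int.fract (k * x i)⌋
  have hf : ∀ k ∈ Finset.range (N ^ n + 1),
      f k ∈ Fintype.piFinset (fun _ : ι => Finset.Ico (0 : ℤ) N) := by
    intro k _
    rw [Fintype.mem_piFinset]
    intro i
    rw [Finset.mem_Ico]
    constructor
    · exact Int.floor_nonneg.2 (mul_nonneg hNpos.le (Int.fract_nonneg _))
    · rw [Int.floor_lt]
      have := Int.fract_lt_one ((k : ℝ) * x i)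
      push_cast
      nlinarith
  obtain ⟨a, ha, b, hb, hab, hfab⟩ := Finset.exists_ne_map_eq_of_card_lt_of_maps_to (by
    simp only [Fintype.card_piFinset, Int.card_Ico, sub_zero, Int.toNat_natCast, Finset.prod_const,
      Finset.card_range, Finset.card_univ]
    exact Nat.lt_succ_of_le (Nat.pow_le_pow_right hN0 hι)) hf
  have key : ∀ a b : ℕ, a ∈ Finset.range (N ^ n + 1) → a > b → f a = f b →
      ∃ t : ℕ, 1 ≤ t ∧ t ≤ N ^ n ∧ ∃ m : ι → ℤ, ∀ i, |t * x i - m i| < ε := by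
    intro a b ha hab hfab
    rw [Finset.mem_range] at ha
    refine ⟨a - b, by omega, by omega, fun i => ⌊a * x i⌋ - ⌊b * x i⌋, fun i => ?_⟩
    have h1 : f a i = f b i := by rw [hfab]
    have h2 := Int.abs_sub_lt_one_of_floor_eq_floor h1
    rw [← mul_sub, abs_mul, abs_of_pos hNpos] at h2
    have h3 : ((a - b : ℕ) : ℝ) * x i - ((⌊a * x i⌋ - ⌊b * x i⌋ : ℤ) : ℝ)
        = Int.fract (a * x i) - Int.fract (b * x i) := by
      rw [Nat.cast_sub hab.le, Int.fract, Int.fract]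
      push_cast
      ring
    rw [h3]
    rw [div_lt_iff₀ hε] at hN
    by_contra h4
    push Not at h4
    nlinarith
  rcases lt_or_gt_of_ne hab with h | h
  · exact key b a hb h hfab.symm
  · exact key a b ha h hfab

/-- Barycentric coordinates admitting no other small relation. -/
def GoodBary {ι : Type} [Fintype ι] (l : ι → ℝ) : Prop :=
  ∀ (t : ℕ) (m : ι → ℤ), 1 ≤ t → ∑ i, m i = t → (∀ i, (m i : ℝ) < t * l i + l i) →
    ∀ i, (m i : ℝ) = t * l i

lemma good_bary_step (n : ℕ) (k : ℕ) : ∃ δ : ℝ, 0 < δ ∧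
    ∀ (ι : Type) [Fintype ι], Fintype.card ι ≤ n → ∀ l : ι → ℝ, (∀ i, 0 < l i) →
      ∑ i, l i = 1 → GoodBary l →
      (∀ i, δ ≤ l i) ∨ k ≤ (Finset.univ.filter fun i => δ ≤ l i).card := by
  induction k with
  | zero => exact ⟨1, one_pos, fun ι _ _ l _ _ _ => Or.inr (Nat.zero_le _)⟩
  | succ k ih =>
    obtain ⟨δ, hδ, ih⟩ := ih
    set e : ℝ := min δ (1 / (n + 1)) with he
    have hepos : 0 < e := lt_min hδ (by positivity)
    obtain ⟨T, hT, hD⟩ := dirichlet_sim n e hepos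
    have hTpos : (0 : ℝ) < T := by exact_mod_cast hT
    have hT1 : (1 : ℝ) ≤ T := by exact_mod_cast hT
    have hce : e / T ≤ δ := by
      rw [div_le_iff₀ hTpos]
      have : e ≤ δ := min_le_left _ _
      nlinarith
    refine ⟨e / T, by positivity, ?_⟩
    intro ι _ hι l hl hsum hgood
    classical
    rcases ih ι hι l hl hsum hgood with h | h
    · exact Or.inl fun i => hce.trans (h i)
    by_cases hex : ∃ i, l i < δ ∧ e / T ≤ l i
    · obtain ⟨j, hj1, hj2⟩ := hex
      right
      refine lt_of_le_of_lt h (Finset.card_lt_card ?_)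
      rw [Finset.ssubset_iff_of_subset]
      · exact ⟨j, by simp [hj2], by simp [hj1]⟩
      · intro i hi
        simp only [Finset.mem_filter, Finset.mem_univ, true_and] at hi ⊢
        exact hce.trans hi
    · push Not at hex
      left
      obtain ⟨t, ht1, htT, m, hm⟩ := hD ι hι l
      have htpos : (0 : ℝ) < t := by exact_mod_cast ht1
      have htT' : (t : ℝ) ≤ T := by exact_mod_cast htT
      let m' : ι → ℤ := fun i => if δ ≤ l i then m i else 0
      have herr : ∀ i, |t * l i - m' i| ≤ e := by
        intro i
        by_cases hi : δ ≤ l i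
        · simp only [m', if_pos hi]; exact (hm i).le
        · simp only [m', if_neg hi]
          have h1 := hex i (not_le.1 hi)
          rw [lt_div_iff₀ hTpos] at h1
          have h2 := hl i
          rw [Int.cast_zero, sub_zero, abs_of_pos (by positivity)]
          nlinarith
      have hs : ∑ i, m' i = t := by
        have h1 : |∑ i, (t * l i - m' i)| < 1 := by
          calc |∑ i, (t * l i - m' i)| ≤ ∑ i, |t * l i - m' i| := Finset.abs_sum_le_sum_abs _ _
            _ ≤ ∑ i : ι, e := Finset.sum_le_sum fun i _ => herr i
            _ = Fintype.card ι * e := by simp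
            _ ≤ n * (1 / (n + 1)) := by
                have : (Fintype.card ι : ℝ) ≤ n := by exact_mod_cast hι
                have h3 : e ≤ 1 / (n + 1) := min_le_right _ _
                gcongr
            _ < 1 := by
                rw [mul_one_div, div_lt_one (by positivity)]; linarith
        rw [Finset.sum_sub_distrib, ← Finset.mul_sum, hsum, mul_one] at h1
        have h2 : |(t : ℤ) - ∑ i, m' i| < 1 := by
          have : ((|(t : ℤ) - ∑ i, m' i| : ℤ) : ℝ) < 1 := by push_cast; exact h1
          exact_mod_cast this
        rw [Int.abs_lt_one_iff] at h2
        omega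
      have hg := hgood t m' ht1 hs (by
        intro i
        by_cases hi : δ ≤ l i
        · simp only [m', if_pos hi]
          have h1 := (abs_lt.1 (hm i)).1
          have : e ≤ δ := min_le_left _ _
          linarith
        · simp only [m', if_neg hi]
          have h2 := hl i
          push_cast
          positivity)
      intro i
      by_cases hi : δ ≤ l i
      · exact hce.trans hi
      · exfalso
        have h1 := hg i
        simp only [m', if_neg hi] at h1
        have h2 := hl i
        have : 0 < t * l i := by positivity
        rw [← h1] at this
        simp at this

lemma good_bary_bound (n : ℕ) : ∃ δ : ℝ, 0 < δ ∧
    ∀ (ι : Type) [Fintype ι], Fintype.card ι ≤ n → ∀ l : ι → ℝ, (∀ i, 0 < l i) →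
      ∑ i, l i = 1 → GoodBary l → ∀ i, δ ≤ l i := by
  obtain ⟨δ, hδ, h⟩ := good_bary_step n n
  refine ⟨δ, hδ, fun ι _ hι l hl hs hg => ?_⟩
  rcases h ι hι l hl hs hg with h | h
  · exact h
  · have h1 : (Finset.univ.filter fun i => δ ≤ l i) = Finset.univ := by
      apply Finset.eq_univ_of_card
      exact le_antisymm (Finset.card_le_univ _) (hι.trans h)
    intro i
    have := Finset.mem_univ i
    rw [← h1] at this
    simpa using this

/-- A finite set of lattice points whose hull has `0` as its only interior lattice point. -/
structure Centered {d : ℕ} (V : Finset (Fin d → ℝ)) : Prop where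
  lat : ∀ x ∈ V, IsLatticePt x
  zero_int : (0 : Fin d → ℝ) ∈ interior (convexHull ℝ (V : Set (Fin d → ℝ)))
  uniq : ∀ x ∈ interior (convexHull ℝ (V : Set (Fin d → ℝ))), IsLatticePt x → x = 0

lemma smul_mem_interior_of_lt {d : ℕ} {P : Set (Fin d → ℝ)} (hP : Convex ℝ P)
    (h0 : (0 : Fin d → ℝ) ∈ interior P) {z : Fin d → ℝ} (hz : z ∈ P) {s : ℝ} (hs0 : 0 ≤ s)
    (hs : s < 1) : s • z ∈ interior P := by
  have := hP.combo_interior_self_mem_interior h0 hz (sub_pos.2 hs) hs0 (by ring)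
  simpa using this

lemma isLatticePt_sum {d : ℕ} {ι : Type*} (s : Finset ι) (m : ι → ℤ) (p : ι → Fin d → ℝ)
    (hp : ∀ i ∈ s, IsLatticePt (p i)) : IsLatticePt (∑ i ∈ s, (m i : ℝ) • p i) := by
  intro j
  choose! k hk using hp
  refine ⟨∑ i ∈ s, m i * k i j, ?_⟩
  rw [Finset.sum_apply]
  push_cast
  exact Finset.sum_congr rfl fun i hi => by simp [hk i hi j]

lemma isLatticePt_neg {d : ℕ} {x : Fin d → ℝ} (h : IsLatticePt x) : IsLatticePt (-x) := by
  intro j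
  obtain ⟨n, hn⟩ := h j
  exact ⟨-n, by simp [hn]⟩

lemma pos_combo_mem_interior {d : ℕ} {P : Set (Fin d → ℝ)} (hP : Convex ℝ P)
    (h0 : (0 : Fin d → ℝ) ∈ interior P) {ι : Type} [Fintype ι] (p : ι → Fin d → ℝ)
    (hp : ∀ i, p i ∈ P) (l b : ι → ℝ) (hl : ∑ i, l i = 1) (hlpos : ∀ i, 0 < l i)
    (hl0 : ∑ i, l i • p i = 0)
    (hb : ∑ i, b i = 1) (hbpos : ∀ i, 0 < b i) : ∑ i, b i • p i ∈ interior P := by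
  have hη : ∃ η : ℝ, 0 < η ∧ η < 1 ∧ ∀ i, η * l i ≤ b i := by
    have hne : (Finset.univ : Finset ι).Nonempty := by
      by_contra h
      rw [Finset.not_nonempty_iff_eq_empty] at h
      rw [h] at hl
      simp at hl
    obtain ⟨i₀, -, hi₀⟩ := Finset.exists_min_image Finset.univ b hne
    refine ⟨min (b i₀) (1 / 2), lt_min (hbpos _) (by norm_num),
      lt_of_le_of_lt (min_le_right _ _) (by norm_num), fun i => ?_⟩
    have h1 : l i ≤ 1 := by
      rw [← hl]
      exact Finset.single_le_sum (fun j _ => (hlpos j).le) (Finset.mem_univ i)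
    have h2 := hi₀ i (Finset.mem_univ i)
    have h3 := min_le_left (b i₀) (1 / 2)
    have h4 : 0 < min (b i₀) (1 / 2) := lt_min (hbpos _) (by norm_num)
    have h5 := hlpos i
    nlinarith
  obtain ⟨η, hη0, hη1, hη⟩ := hη
  have h1 : 0 < 1 - η := by linarith
  have hz : ∑ i, ((b i - η * l i) / (1 - η)) • p i ∈ P := by
    apply hP.sum_mem
    · intro i _
      exact div_nonneg (by linarith [hη i]) h1.le
    · rw [← Finset.sum_div, Finset.sum_sub_distrib, ← Finset.mul_sum, hl, hb, mul_one,
        div_self h1.ne']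
    · intro i _; exact hp i
  have := smul_mem_interior_of_lt hP h0 hz h1.le (by linarith)
  convert this using 1
  rw [Finset.smul_sum]
  have h2 : ∀ i, (1 - η) • ((b i - η * l i) / (1 - η)) • p i = b i • p i - η • (l i • p i) := by
    intro i
    rw [smul_smul, mul_div_cancel₀ _ h1.ne', sub_smul, mul_smul]
  simp only [h2]
  rw [Finset.sum_sub_distrib, ← Finset.smul_sum, hl0]
  simp

/-- Bounded asymmetry. -/
lemma asymmetry (d : ℕ) : ∃ δ : ℝ, 0 < δ ∧ δ ≤ 1 ∧ ∀ V : Finset (Fin d → ℝ), Centered V →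
    ∀ v ∈ V, -(δ • v) ∈ convexHull ℝ (V : Set (Fin d → ℝ)) := by
  obtain ⟨δ₀, hδ₀, hB⟩ := good_bary_bound (d + 1)
  refine ⟨min δ₀ 1, lt_min hδ₀ one_pos, min_le_right _ _, ?_⟩
  set δ := min δ₀ 1 with hδdef
  have hδpos : 0 < δ := lt_min hδ₀ one_pos
  intro V hV v hv
  set P := convexHull ℝ (V : Set (Fin d → ℝ)) with hPdef
  have hP : Convex ℝ P := convex_convexHull ℝ _
  have h0P : (0 : Fin d → ℝ) ∈ P := interior_subset hV.zero_int
  have hVP : ∀ u ∈ V, u ∈ P := fun u hu => subset_convexHull ℝ _ hu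
  -- a small multiple of `-v` is in `P`
  have hs : ∃ s : ℝ, 0 < s ∧ s • (-v) ∈ P := by
    have hcont : Filter.Tendsto (fun s : ℝ => s • (-v)) (nhds 0) (nhds 0) := by
      have : Continuous (fun s : ℝ => s • (-v)) := by fun_prop
      simpa using this.tendsto 0
    have h1 := hcont.eventually (mem_interior_iff_mem_nhds.1 hV.zero_int)
    obtain ⟨ε, hε, h2⟩ := Metric.eventually_nhds_iff.1 h1
    refine ⟨ε / 2, by positivity, h2 ?_⟩
    rw [Real.dist_eq, sub_zero, abs_of_pos (by positivity)]
    linarith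
  obtain ⟨s, hs, hsv⟩ := hs
  rw [hPdef, Finset.mem_convexHull'] at hsv
  obtain ⟨w, hw0, hw1, hw2⟩ := hsv
  obtain ⟨U, hUV, c, hc, hcs, hind⟩ := conic_carath V.card V (fun u => w u / s) rfl
    (fun u hu => div_nonneg (hw0 u hu) hs.le)
  have hcs' : ∑ u ∈ U, c u • u = -v := by
    rw [hcs]
    have : ∀ u, (w u / s) • u = s⁻¹ • (w u • u) := by
      intro u; rw [smul_smul]; congr 1; ring
    simp only [this]
    rw [← Finset.smul_sum, hw2, smul_smul, inv_mul_cancel₀ hs.ne', one_smul]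
  have hcard : U.card ≤ d := by
    have hli : LinearIndependent ℝ (fun u : U => (u : Fin d → ℝ)) := by
      rw [Fintype.linearIndependent_iff]
      intro g hg
      have h1 := hind (fun u => if h : u ∈ U then g ⟨u, h⟩ else 0) (by
        rw [← Finset.sum_attach]
        simpa using hg)
      intro i
      simpa using h1 i i.2
    have := hli.fintype_card_le_finrank
    simpa using this
  -- barycentric coordinates
  set S : ℝ := 1 + ∑ u ∈ U, c u with hS
  have hSpos : 0 < S := by
    have : 0 ≤ ∑ u ∈ U, c u := Finset.sum_nonneg fun u hu => (hc u hu).le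
    linarith
  let p : Option U → Fin d → ℝ := fun o => o.elim v (fun u => u)
  let cc : Option U → ℝ := fun o => o.elim 1 (fun u => c u)
  let l : Option U → ℝ := fun o => cc o / S
  have hccS : ∑ o, cc o = S := by
    rw [Fintype.sum_option, hS]
    simp only [cc, Option.elim]
    congr 1
    exact Finset.sum_coe_sort U c
  have hccp : ∑ o, cc o • p o = 0 := by
    rw [Fintype.sum_option]
    simp only [cc, p, Option.elim]
    rw [Finset.sum_coe_sort U (fun u => c u • u), hcs']
    simp
  have hccpos : ∀ o, 0 < cc o := by
    rintro (_ | u)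
    · simp [cc]
    · exact hc u u.2
  have hlpos : ∀ o, 0 < l o := fun o => div_pos (hccpos o) hSpos
  have hlsum : ∑ o, l o = 1 := by
    simp only [l]
    rw [← Finset.sum_div, hccS, div_self hSpos.ne']
  have hlp : ∑ o, l o • p o = 0 := by
    have : ∀ o, l o • p o = S⁻¹ • (cc o • p o) := by
      intro u; rw [smul_smul]; congr 1; simp only [l]; ring
    simp only [this]
    rw [← Finset.smul_sum, hccp, smul_zero]
  have hpV : ∀ o, p o ∈ V := by
    rintro (_ | u)
    · exact hv
    · exact hUV u.2
  have hgood : GoodBary l := by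
    intro t m ht hmt hml
    let b : Option U → ℝ := fun o => l o + t * l o - m o
    have hbpos : ∀ o, 0 < b o := fun o => by
      have := hml o
      simp only [b]; linarith
    have hbsum : ∑ o, b o = 1 := by
      simp only [b]
      rw [Finset.sum_sub_distrib, Finset.sum_add_distrib, ← Finset.mul_sum, hlsum]
      have : (∑ o, (m o : ℝ)) = t := by exact_mod_cast hmt
      rw [this]; ring
    have hbp : ∑ o, b o • p o = -∑ o, (m o : ℝ) • p o := by
      simp only [b, sub_smul, add_smul, mul_smul]
      rw [Finset.sum_sub_distrib, Finset.sum_add_distrib, ← Finset.smul_sum, hlp]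
      simp
    have hintr := pos_combo_mem_interior hP hV.zero_int p (fun o => hVP _ (hpV o)) l b hlsum hlpos
      hlp hbsum hbpos
    have hzero := hV.uniq _ hintr (by
      rw [hbp]
      exact isLatticePt_neg (isLatticePt_sum _ _ _ fun o _ => hV.lat _ (hpV o)))
    rw [hbp, neg_eq_zero] at hzero
    -- uniqueness of the relation
    have hrel : ∀ o, (m o : ℝ) = m none * cc o := by
      have h1 : ∑ u : U, ((m (some u) : ℝ) - m none * c u) • (u : Fin d → ℝ) = 0 := by
        simp only [sub_smul, mul_smul]
        rw [Finset.sum_sub_distrib, ← Finset.smul_sum, Finset.sum_coe_sort U (fun u => c u • u),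
          hcs']
        rw [Fintype.sum_option] at hzero
        simp only [p, Option.elim] at hzero
        rw [← hzero]
        simp [add_comm]
      have h2 := hind (fun u => if h : u ∈ U then (m (some ⟨u, h⟩) : ℝ) - m none * c u else 0) (by
        rw [← Finset.sum_attach]
        simpa using h1)
      rintro (_ | u)
      · simp [cc]
      · have := h2 u u.2
        simp only [u.2, dif_pos] at this
        simp only [cc, Option.elim]
        linarith
    have hS' : (t : ℝ) = m none * S := by
      rw [← hccS, Finset.mul_sum, ← Finset.sum_congr rfl fun o _ => hrel o]
      exact_mod_cast hmt.symm
    intro o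
    simp only [l]
    rw [hrel o, hS']
    field_simp
  have hbd := hB (Option U) (by simpa using hcard) l hlpos hlsum hgood none
  have hδS : δ * S ≤ 1 := by
    have h1 : δ ≤ 1 / S := (min_le_left _ _).trans hbd
    rwa [le_div_iff₀ hSpos] at h1
  -- conclusion
  have hmem : ∑ o : Option U, (o.elim (1 - δ * ∑ u ∈ U, c u) (fun u => δ * c u) : ℝ) •
      (o.elim 0 (fun u => (u : Fin d → ℝ)) : Fin d → ℝ) ∈ P := by
    apply hP.sum_mem
    · rintro (_ | u) _
      · simp only [Option.elim]
        rw [hS] at hδS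
        linarith
      · exact mul_nonneg hδpos.le (hc u u.2).le
    · rw [Fintype.sum_option]
      simp only [Option.elim]
      rw [← Finset.mul_sum, Finset.sum_coe_sort U c]
      ring
    · rintro (_ | u) _
      · exact h0P
      · exact hVP _ (hUV u.2)
  convert hmem using 1
  rw [Fintype.sum_option]
  simp only [Option.elim, smul_zero, zero_add, mul_smul]
  rw [← Finset.smul_sum, Finset.sum_coe_sort U (fun u => c u • u), hcs', smul_neg]

lemma map_int_mul {d : ℕ} (A B : Matrix (Fin d) (Fin d) ℤ) :
    (A * B).map (Int.cast : ℤ → ℝ) = A.map (Int.cast : ℤ → ℝ) * B.map (Int.cast : ℤ → ℝ) :=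
  Matrix.map_mul (f := Int.castRingHom ℝ)

open Matrix in
lemma exists_max_basis {d : ℕ} (V : Finset (Fin d → ℝ))
    (h0 : (0 : Fin d → ℝ) ∈ interior (convexHull ℝ (V : Set (Fin d → ℝ)))) :
    ∃ f : Fin d → (Fin d → ℝ), (∀ i, f i ∈ V) ∧
      (Matrix.of fun i j => f j i).det ≠ 0 ∧
      ∀ w ∈ V, ∀ i, |((Matrix.of fun i j => f j i)⁻¹ *ᵥ w) i| ≤ 1 := by
  classical
  have hspan : Submodule.span ℝ (V : Set (Fin d → ℝ)) = ⊤ := by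
    apply Submodule.eq_top_of_nonempty_interior'
    exact ⟨0, interior_mono (convexHull_min Submodule.subset_span
      (Submodule.convex _)) h0⟩
  obtain ⟨b, hbV, hbs, hbli⟩ := exists_linearIndependent ℝ (V : Set (Fin d → ℝ))
  rw [hspan] at hbs
  let B := Module.Basis.mk hbli (by rw [Subtype.range_coe, hbs])
  have : Finite b := (V.finite_toSet.subset hbV).to_subtype
  have : Fintype b := Fintype.ofFinite b
  have hcard : Fintype.card b = Fintype.card (Fin d) := by
    rw [← Module.finrank_eq_card_basis B]; simp
  let e : Fin d ≃ b := (Fintype.equivOfCardEq hcard).symm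
  have hg : ∃ g : Fin d → V, (Matrix.of fun i j => (g j : Fin d → ℝ) i).det ≠ 0 := by
    refine ⟨fun j => ⟨e j, hbV (e j).2⟩, ?_⟩
    have h1 : LinearIndependent ℝ (Matrix.of fun i j => (e j : Fin d → ℝ) i).col :=
      hbli.comp e e.injective
    rw [Matrix.linearIndependent_cols_iff_isUnit, Matrix.isUnit_iff_isUnit_det] at h1
    exact h1.ne_zero
  obtain ⟨g₀, hg₀⟩ := hg
  obtain ⟨g, -, hmax⟩ := Finset.exists_max_image (Finset.univ : Finset (Fin d → V))
    (fun g => |(Matrix.of fun i j => (g j : Fin d → ℝ) i).det|) ⟨g₀, Finset.mem_univ _⟩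
  set M : Matrix (Fin d) (Fin d) ℝ := Matrix.of fun i j => (g j : Fin d → ℝ) i with hM
  have hdet : M.det ≠ 0 := by
    have := hmax g₀ (Finset.mem_univ _)
    have h2 := abs_pos.2 hg₀
    exact abs_pos.1 (h2.trans_le this)
  refine ⟨fun j => g j, fun i => (g i).2, hdet, ?_⟩
  intro w hw i
  have h1 := hmax (Function.update g i ⟨w, hw⟩) (Finset.mem_univ _)
  have h2 : (Matrix.of fun a j => ((Function.update g i ⟨w, hw⟩ j : V) : Fin d → ℝ) a)
      = M.updateCol i w := by
    ext a j
    by_cases hj : j = i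
    · subst hj; simp
    · simp [hj, hM]
  simp only [h2] at h1
  rw [← Matrix.cramer_apply, Matrix.cramer_eq_adjugate_mulVec] at h1
  have h3 : (M⁻¹ *ᵥ w) i = (M.adjugate *ᵥ w) i / M.det := by
    rw [Matrix.inv_def, Ring.inverse_eq_inv', Matrix.smul_mulVec, Pi.smul_apply, smul_eq_mul]
    ring
  rw [← hM, h3, abs_div, div_le_one (abs_pos.2 hdet)]
  exact h1

lemma smul_vertex_mem {d : ℕ} {P : Set (Fin d → ℝ)} (hP : Convex ℝ P)
    (h0 : (0 : Fin d → ℝ) ∈ P) {δ : ℝ} (hδ : 0 < δ) (hδ1 : δ ≤ 1) {v : Fin d → ℝ} (hv : v ∈ P)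
    (hv' : -(δ • v) ∈ P) {b : ℝ} (hb : |b| ≤ δ) : b • v ∈ P := by
  rcases le_total 0 b with h | h
  · rw [abs_of_nonneg h] at hb
    exact hP.smul_mem_of_zero_mem h0 hv ⟨h, hb.trans hδ1⟩
  · rw [abs_of_nonpos h] at hb
    have := hP.smul_mem_of_zero_mem h0 hv' (t := -b / δ)
      ⟨div_nonneg (by linarith) hδ.le, by rw [div_le_one hδ]; exact hb⟩
    convert this using 1
    rw [smul_neg, smul_smul, div_mul_cancel₀ _ hδ.ne', neg_smul, neg_neg]

open Matrix in
/-- Uniform denominators. -/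
lemma uniform_denominator (d : ℕ) : ∃ N : ℕ, 0 < N ∧ ∀ V : Finset (Fin d → ℝ), Centered V →
    ∃ M K : Matrix (Fin d) (Fin d) ℤ, M * K = (N : ℤ) • (1 : Matrix (Fin d) (Fin d) ℤ) ∧
      K * M = (N : ℤ) • (1 : Matrix (Fin d) (Fin d) ℤ) ∧
      ∀ w : Fin d → ℤ, (fun i => (w i : ℝ)) ∈ V → ∀ i, |(K *ᵥ w) i| ≤ N := by
  obtain ⟨δ, hδ, hδ1, hasym⟩ := asymmetry d
  obtain ⟨T, hT, hD⟩ := dirichlet_sim d (δ / (2 * (d + 1))) (by positivity)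
  refine ⟨T.factorial, Nat.factorial_pos T, ?_⟩
  intro V hV
  obtain ⟨f, hfV, hdet, hmax⟩ := exists_max_basis V hV.zero_int
  set M : Matrix (Fin d) (Fin d) ℝ := Matrix.of fun i j => f j i with hM
  set P := convexHull ℝ (V : Set (Fin d → ℝ)) with hPdef
  have hP : Convex ℝ P := convex_convexHull ℝ _
  have h0P : (0 : Fin d → ℝ) ∈ P := interior_subset hV.zero_int
  have hVP : ∀ u ∈ V, u ∈ P := fun u hu => subset_convexHull ℝ _ hu
  have hMu : IsUnit M.det := isUnit_iff_ne_zero.2 hdet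
  have hMvec : ∀ a : Fin d → ℝ, M *ᵥ a = ∑ i, a i • f i := by
    intro a
    ext j
    simp [Matrix.mulVec, dotProduct, hM, Finset.sum_apply, mul_comm]
  -- small coordinates force zero
  have hsmall : ∀ b : Fin d → ℝ, (∀ i, |b i| < δ / (2 * (d + 1))) → IsLatticePt (M *ᵥ b) →
      b = 0 := by
    intro b hb hlat
    have h1 : (2 : ℝ) • (M *ᵥ b) ∈ P := by
      have h2 : ∑ o : Option (Fin d), (1 / (d + 1) : ℝ) •
          (o.elim 0 (fun i => (2 * (d + 1) * b i) • f i) : Fin d → ℝ) ∈ P := by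
        apply hP.sum_mem
        · intro i _; positivity
        · simp
          field_simp
        · rintro (_ | i) _
          · exact h0P
          · refine smul_vertex_mem hP h0P hδ hδ1 (hVP _ (hfV i)) (hasym V hV _ (hfV i)) ?_
            have := (hb i).le
            rw [le_div_iff₀ (by positivity)] at this
            rw [abs_mul, abs_of_pos (by positivity)]
            linarith
      convert h2 using 1
      rw [Fintype.sum_option, hMvec, Finset.smul_sum]
      simp only [Option.elim, smul_zero, zero_add]
      refine Finset.sum_congr rfl fun i _ => ?_
      rw [smul_smul, smul_smul]
      congr 1
      field_simp
    have h3 := smul_mem_interior_of_lt hP hV.zero_int h1 (s := 1 / 2) (by norm_num) (by norm_num)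
    rw [smul_smul] at h3
    norm_num at h3
    have h4 := hV.uniq _ h3 hlat
    exact Matrix.eq_zero_of_mulVec_eq_zero hdet h4
  have hlatM : ∀ m : Fin d → ℤ, IsLatticePt (M *ᵥ fun i => (m i : ℝ)) := by
    intro m
    rw [hMvec]
    exact isLatticePt_sum _ _ _ fun i _ => hV.lat _ (hfV i)
  have hMinv : ∀ x, M *ᵥ (M⁻¹ *ᵥ x) = x := by
    intro x
    rw [Matrix.mulVec_mulVec, Matrix.mul_nonsing_inv _ hMu, Matrix.one_mulVec]
  have hintr : ∀ x, IsLatticePt x → ∀ i, ∃ k : ℤ, (T.factorial : ℝ) * (M⁻¹ *ᵥ x) i = k := by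
    intro x hx i
    obtain ⟨t, ht1, htT, m, hm⟩ := hD (Fin d) (by simp) (M⁻¹ *ᵥ x)
    have h1 := hsmall (fun i => t * (M⁻¹ *ᵥ x) i - m i) hm (by
      have h2 : (fun i => (t : ℝ) * (M⁻¹ *ᵥ x) i - m i)
          = (t : ℝ) • (M⁻¹ *ᵥ x) - fun i => (m i : ℝ) := by
        ext i; simp
      rw [h2, Matrix.mulVec_sub, Matrix.mulVec_smul, hMinv]
      intro j
      obtain ⟨a, ha⟩ := hx j
      obtain ⟨c, hc⟩ := hlatM m j
      refine ⟨t * a - c, ?_⟩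
      rw [Pi.sub_apply, hc, Pi.smul_apply, ha]
      push_cast
      simp)
    obtain ⟨q, hq⟩ := Nat.dvd_factorial ht1 htT
    refine ⟨q * m i, ?_⟩
    have h3 := congrFun h1 i
    simp only [Pi.zero_apply] at h3
    rw [hq]
    push_cast
    linear_combination (q : ℝ) * h3
  -- integral matrices
  have hfl : ∀ i j, ∃ n : ℤ, M i j = n := fun i j => hV.lat _ (hfV j) i
  choose MZ hMZ using hfl
  have hKl : ∀ i j, ∃ n : ℤ, (T.factorial : ℝ) * M⁻¹ i j = n := by
    intro i j
    have := hintr (Pi.single j 1) (by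
      intro a
      by_cases h : a = j
      · subst h; exact ⟨1, by simp⟩
      · exact ⟨0, by simp [h]⟩) i
    simpa using this
  choose KZ hKZ using hKl
  have hMZ' : (Matrix.of MZ).map (Int.cast : ℤ → ℝ) = M := by
    ext i j; simp [hMZ]
  have hKZ' : (Matrix.of KZ).map (Int.cast : ℤ → ℝ) = (T.factorial : ℝ) • M⁻¹ := by
    ext i j; simp [hKZ]
  have hinj : Function.Injective (fun A : Matrix (Fin d) (Fin d) ℤ => A.map (Int.cast : ℤ → ℝ)) :=
    Matrix.map_injective Int.cast_injective
  have hNmap : (((T.factorial : ℕ) : ℤ) • (1 : Matrix (Fin d) (Fin d) ℤ)).map (Int.cast : ℤ → ℝ)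
      = (T.factorial : ℝ) • 1 := by
    ext i j
    rw [Matrix.map_apply, Matrix.smul_apply, Matrix.smul_apply, Matrix.one_apply,
      Matrix.one_apply]
    split_ifs <;> simp
  refine ⟨Matrix.of MZ, Matrix.of KZ, hinj ?_, hinj ?_, ?_⟩
  · simp only
    rw [hNmap, map_int_mul, hMZ', hKZ',
      Matrix.mul_smul, Matrix.mul_nonsing_inv _ hMu]
  · simp only
    rw [hNmap, map_int_mul, hMZ', hKZ',
      Matrix.smul_mul, Matrix.nonsing_inv_mul _ hMu]
  · intro w hw i
    have h1 : (((Matrix.of KZ *ᵥ w) i : ℤ) : ℝ)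
        = (T.factorial : ℝ) * (M⁻¹ *ᵥ fun i => (w i : ℝ)) i := by
      simp only [Matrix.mulVec, dotProduct, Int.cast_sum, Int.cast_mul, Matrix.of_apply,
        Finset.mul_sum, ← hKZ, mul_assoc]
    have h2 := hmax _ hw i
    have h3 : |(((Matrix.of KZ *ᵥ w) i : ℤ) : ℝ)| ≤ (T.factorial : ℝ) := by
      rw [h1, abs_mul, abs_of_nonneg (by positivity)]
      have : (0 : ℝ) ≤ T.factorial := by positivity
      nlinarith
    exact_mod_cast h3

open Matrix in
/-- `P` has invariant `(Mb, W)` with respect to the denominator `N`. -/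
def HasInv {d : ℕ} (N : ℕ) (P : Set (Fin d → ℝ)) (Mb : Matrix (Fin d) (Fin d) (ZMod N))
    (W : Finset (Fin d → ℤ)) : Prop :=
  ∃ (M K : Matrix (Fin d) (Fin d) ℤ) (t : Fin d → ℤ),
    M * K = (N : ℤ) • (1 : Matrix (Fin d) (Fin d) ℤ) ∧
    K * M = (N : ℤ) • (1 : Matrix (Fin d) (Fin d) ℤ) ∧
    M.map (Int.cast : ℤ → ZMod N) = Mb ∧
    P = (fun y => (N : ℝ)⁻¹ • (M.map (Int.cast : ℤ → ℝ) *ᵥ y) + fun i => (t i : ℝ)) ''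
      convexHull ℝ ((fun (k : Fin d → ℤ) (i : Fin d) => (k i : ℝ)) '' (W : Set (Fin d → ℤ)))

open Matrix in
lemma hasInv_equiv {d N : ℕ} (hN : 0 < N) {P Q : Set (Fin d → ℝ)}
    {Mb : Matrix (Fin d) (Fin d) (ZMod N)} {W : Finset (Fin d → ℤ)}
    (hP : HasInv N P Mb W) (hQ : HasInv N Q Mb W) : AffineLatticeEquiv P Q := by
  obtain ⟨M, K, t, hMK, hKM, hMb, rfl⟩ := hP
  obtain ⟨M', K', t', hMK', hKM', hMb', rfl⟩ := hQ
  have hE : ∀ i j, ∃ e : ℤ, M' i j = M i j + N * e := by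
    intro i j
    have h1 : ((M i j : ℤ) : ZMod N) = (M' i j : ℤ) := by
      have := congrFun (congrFun (hMb.trans hMb'.symm) i) j
      simpa using this
    rw [ZMod.intCast_eq_intCast_iff_dvd_sub] at h1
    obtain ⟨e, he⟩ := h1
    exact ⟨e, by linarith⟩
  choose E hE using hE
  have hME : M' = M + (N : ℤ) • Matrix.of E := by
    ext i j
    rw [Matrix.add_apply, Matrix.smul_apply, hE]
    simp
  set F : Matrix (Fin d) (Fin d) ℤ := Matrix.of E with hF
  have hAM : (1 + F * K) * M = M' := by
    rw [add_mul, one_mul, mul_assoc, hKM, Matrix.mul_smul, mul_one, hME]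
  have hBM : (1 - F * K') * M' = M := by
    rw [sub_mul, one_mul, mul_assoc, hKM', Matrix.mul_smul, mul_one, hME, add_sub_cancel_right]
  have hBA : (1 - F * K') * (1 + F * K) = 1 := by
    have h1 : (1 - F * K') * (1 + F * K) * (M * K) = 1 * (M * K) := by
      rw [← mul_assoc, mul_assoc (1 - F * K'), hAM, hBM, one_mul]
    rw [hMK, Matrix.mul_smul, Matrix.mul_smul, mul_one, mul_one] at h1
    ext i j
    have h2 := congrFun (congrFun h1 i) j
    rw [Matrix.smul_apply, Matrix.smul_apply, smul_eq_mul, smul_eq_mul] at h2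
    exact mul_left_cancel₀ (by exact_mod_cast hN.ne') h2
  set A := 1 + F * K with hA
  refine ⟨A, t' - A *ᵥ t, Matrix.isUnit_det_of_left_inverse hBA, ?_⟩
  rw [Set.image_image]
  refine Set.image_congr fun y _ => ?_
  have h1 : (fun i => (((t' - A *ᵥ t) i : ℤ) : ℝ))
      = (fun i => (t' i : ℝ)) - A.map (Int.cast : ℤ → ℝ) *ᵥ (fun i => (t i : ℝ)) := by
    ext i
    simp [Matrix.mulVec, dotProduct]
  rw [h1, Matrix.mulVec_add, Matrix.mulVec_smul, Matrix.mulVec_mulVec, ← map_int_mul, hAM]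
  abel

open Matrix Pointwise in
lemma hasInv_exists (d : ℕ) : ∃ N : ℕ, 0 < N ∧ ∀ P : Set (Fin d → ℝ),
    IsLatticePolytope P → (∃! x : Fin d → ℝ, x ∈ interior P ∧ IsLatticePt x) →
    ∃ Mb : Matrix (Fin d) (Fin d) (ZMod N),
      ∃ W ∈ (Fintype.piFinset fun _ : Fin d => Finset.Icc (-(N : ℤ)) N).powerset,
        HasInv N P Mb W := by
  classical
  obtain ⟨N, hN, hden⟩ := uniform_denominator d
  refine ⟨N, hN, ?_⟩
  rintro P ⟨V, hVlat, rfl⟩ ⟨x₀, ⟨hx₀, hx₀l⟩, huniq⟩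
  choose t ht using hx₀l
  have hx₀t : x₀ = fun i => (t i : ℝ) := funext ht
  set V' : Finset (Fin d → ℝ) := V.image (fun v => -x₀ + v) with hV'
  have hV'coe : (V' : Set (Fin d → ℝ)) = (-x₀) +ᵥ (V : Set (Fin d → ℝ)) := by
    rw [hV', Finset.coe_image]; rfl
  have hhull : convexHull ℝ (V' : Set (Fin d → ℝ))
      = (-x₀) +ᵥ convexHull ℝ (V : Set (Fin d → ℝ)) := by
    rw [hV'coe, convexHull_vadd]
  have hmemint : ∀ x, x ∈ interior (convexHull ℝ (V' : Set (Fin d → ℝ))) ↔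
      x₀ + x ∈ interior (convexHull ℝ (V : Set (Fin d → ℝ))) := by
    intro x
    rw [hhull, interior_vadd, Set.mem_vadd_set_iff_neg_vadd_mem, neg_neg, vadd_eq_add]
  have hcent : Centered V' := by
    refine ⟨?_, ?_, ?_⟩
    · intro x hx
      rw [hV', Finset.mem_image] at hx
      obtain ⟨v, hv, rfl⟩ := hx
      intro i
      obtain ⟨n, hn⟩ := hVlat v hv i
      exact ⟨-t i + n, by simp [hn, ht]⟩
    · rw [hmemint, add_zero]; exact hx₀
    · intro x hx hxl
      rw [hmemint] at hx
      have := huniq (x₀ + x) ⟨hx, fun i => by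
        obtain ⟨n, hn⟩ := hxl i
        exact ⟨t i + n, by simp [hn, ht]⟩⟩
      simpa using this
  obtain ⟨M, K, hMK, hKM, hbd⟩ := hden V' hcent
  let fl : (Fin d → ℝ) → (Fin d → ℤ) := fun v i => ⌊v i⌋
  have hfl : ∀ v ∈ V', (fun i => (fl v i : ℝ)) = v := by
    intro v hv
    ext i
    obtain ⟨n, hn⟩ := hcent.lat v hv i
    simp [fl, hn]
  refine ⟨_, V'.image (fun v => K *ᵥ fl v), ?_, M, K, t, hMK, hKM, rfl, ?_⟩
  · rw [Finset.mem_powerset]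
    intro k hk
    rw [Finset.mem_image] at hk
    obtain ⟨v, hv, rfl⟩ := hk
    rw [Fintype.mem_piFinset]
    intro i
    rw [Finset.mem_Icc, ← abs_le]
    exact hbd (fl v) (by rw [hfl v hv]; exact hv) i
  · let L : (Fin d → ℝ) →ₗ[ℝ] (Fin d → ℝ) :=
      (N : ℝ)⁻¹ • (M.map (Int.cast : ℤ → ℝ)).mulVecLin
    have hL : ∀ y, L y = (N : ℝ)⁻¹ • (M.map (Int.cast : ℤ → ℝ) *ᵥ y) := fun y => rfl
    have hcast : ∀ (B : Matrix (Fin d) (Fin d) ℤ) (z : Fin d → ℤ),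
        B.map (Int.cast : ℤ → ℝ) *ᵥ (fun i => (z i : ℝ)) = fun i => ((B *ᵥ z) i : ℝ) := by
      intro B z
      ext i
      simp [Matrix.mulVec, dotProduct]
    have hLv : ∀ v ∈ V', L (fun i => ((K *ᵥ fl v) i : ℝ)) = v := by
      intro v hv
      rw [hL, hcast, Matrix.mulVec_mulVec, hMK]
      conv_rhs => rw [← hfl v hv]
      ext i
      have hN' : (N : ℝ) ≠ 0 := by exact_mod_cast hN.ne'
      rw [Matrix.smul_mulVec, Matrix.one_mulVec]
      simp only [Pi.smul_apply, smul_eq_mul]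
      push_cast
      field_simp
    have himg : L '' ((fun (k : Fin d → ℤ) (i : Fin d) => (k i : ℝ)) ''
        ((V'.image (fun v => K *ᵥ fl v) : Finset _) : Set (Fin d → ℤ)))
        = (V' : Set (Fin d → ℝ)) := by
      rw [Finset.coe_image, Set.image_image, Set.image_image]
      rw [Set.image_congr (g := id) (fun v hv => hLv v hv), Set.image_id]
    have h1 := L.image_convexHull ((fun (k : Fin d → ℤ) (i : Fin d) => (k i : ℝ)) ''
        ((V'.image (fun v => K *ᵥ fl v) : Finset _) : Set (Fin d → ℤ)))
    rw [himg, hhull] at h1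
    have h2 : convexHull ℝ (V : Set (Fin d → ℝ))
        = (fun z => z + x₀) '' ((-x₀) +ᵥ convexHull ℝ (V : Set (Fin d → ℝ))) := by
      rw [← Set.image_vadd, Set.image_image]
      simp
    rw [h2, ← h1, Set.image_image, hx₀t]
    rfl

lemma finite_one_point (d : ℕ) : ∃ S : Finset (Set (Fin d → ℝ)), ∀ P : Set (Fin d → ℝ),
    IsLatticePolytope P → (∃! x : Fin d → ℝ, x ∈ interior P ∧ IsLatticePt x) →
    ∃ Q ∈ S, AffineLatticeEquiv P Q := by
  classical
  obtain ⟨N, hN, hex⟩ := hasInv_exists d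
  have : NeZero N := ⟨hN.ne'⟩
  let rep : Matrix (Fin d) (Fin d) (ZMod N) × Finset (Fin d → ℤ) → Set (Fin d → ℝ) :=
    fun q => if h : ∃ Q, HasInv N Q q.1 q.2 then h.choose else ∅
  refine ⟨((Finset.univ : Finset (Matrix (Fin d) (Fin d) (ZMod N))) ×ˢ
    (Fintype.piFinset fun _ : Fin d => Finset.Icc (-(N : ℤ)) N).powerset).image rep, ?_⟩
  intro P hP hu
  obtain ⟨Mb, W, hW, hinv⟩ := hex P hP hu
  have h : ∃ Q, HasInv N Q Mb W := ⟨P, hinv⟩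
  refine ⟨rep (Mb, W), Finset.mem_image_of_mem _ (Finset.mem_product.2
    ⟨Finset.mem_univ _, hW⟩), ?_⟩
  have hr : rep (Mb, W) = h.choose := dif_pos h
  rw [hr]
  exact hasInv_equiv hN hinv h.choose_spec

lemma dotp_smul_right {d : ℕ} (v x : Fin d → ℝ) (s : ℝ) : dotp v (s • x) = s * dotp v x := by
  simp only [dotp, Finset.mul_sum, Pi.smul_apply, smul_eq_mul]
  exact Finset.sum_congr rfl fun i _ => by ring

lemma reflexive_unique {d : ℕ} {P : Set (Fin d → ℝ)} (h : IsReflexive P) :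
    ∃! x : Fin d → ℝ, x ∈ interior P ∧ IsLatticePt x := by
  obtain ⟨⟨V, -, hPV⟩, -, h0, ⟨W, hWl, hW⟩⟩ := h
  refine ⟨0, ⟨h0, fun i => ⟨0, by simp⟩⟩, ?_⟩
  rintro x ⟨hx, hxl⟩
  by_contra hne
  have hconv : Convex ℝ P := by rw [hPV]; exact convex_convexHull ℝ _
  have hcomp : IsCompact P := by rw [hPV]; exact V.finite_toSet.isCompact_convexHull (𝕜 := ℝ)
  -- a far multiple outside `P`
  obtain ⟨R, hR⟩ := hcomp.isBounded.exists_norm_le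
  have hxn : 0 < ‖x‖ := norm_pos_iff.2 hne
  have hout : ∃ s : ℝ, 0 < s ∧ s • x ∉ P := by
    refine ⟨(|R| + 1) / ‖x‖, by positivity, fun hmem => ?_⟩
    have h1 := hR _ hmem
    rw [norm_smul, Real.norm_of_nonneg (by positivity), div_mul_cancel₀ _ hxn.ne'] at h1
    linarith [le_abs_self R]
  obtain ⟨s, hs, hsx⟩ := hout
  obtain ⟨f, u, hfP, hfx⟩ := geometric_hahn_banach_closed_point hconv hcomp.isClosed hsx
  have hu : 0 < u := by simpa using hfP 0 (interior_subset h0)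
  let v : Fin d → ℝ := fun i => f (Pi.single i 1) / u
  have hv : ∀ y, dotp v y = f y / u := by
    intro y
    have h1 : f y = ∑ i, y i * f (Pi.single i 1) := by
      conv_lhs => rw [pi_eq_sum_univ' y]
      rw [map_sum]
      refine Finset.sum_congr rfl fun i _ => ?_
      rw [map_smul, smul_eq_mul]
    rw [h1, Finset.sum_div]
    exact Finset.sum_congr rfl fun i _ => by simp only [v]; ring
  have hvp : v ∈ polarDual P := by
    intro y hy
    rw [hv, div_le_one hu]
    exact (hfP y hy).le
  have hvx : 0 < dotp v x := by
    rw [hv]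
    rw [map_smul, smul_eq_mul] at hfx
    have : 0 < f x := by
      by_contra hcon
      push Not at hcon
      nlinarith
    positivity
  -- some vertex of the dual is positive at `x`
  have hw : ∃ w ∈ W, 0 < dotp w x := by
    by_contra hcon
    push Not at hcon
    rw [hW] at hvp
    have hsub : convexHull ℝ (W : Set (Fin d → ℝ)) ⊆ {w | dotp w x ≤ 0} := by
      refine convexHull_min (fun w hw => hcon w hw)
        (convex_halfSpace_le (f := fun w => dotp w x) ?_ 0)
      constructor
      · intro a b; simp [dotp, add_mul, Finset.sum_add_distrib]
      · intro c a; simp [dotp, Finset.mul_sum, mul_assoc]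
    exact absurd (hsub hvp) (not_le.2 hvx)
  obtain ⟨w, hwW, hwx⟩ := hw
  have hwp : w ∈ polarDual P := by rw [hW]; exact subset_convexHull ℝ _ hwW
  have hge : 1 ≤ dotp w x := by
    choose a ha using hWl w hwW
    choose b hb using hxl
    have h1 : dotp w x = ((∑ i, a i * b i : ℤ) : ℝ) := by
      simp [dotp, ha, hb]
    rw [h1] at hwx ⊢
    have h2 : 0 < ∑ i, a i * b i := by exact_mod_cast hwx
    exact_mod_cast h2
  -- but `x` is interior
  have hcont : Filter.Tendsto (fun r : ℝ => r • x) (nhds 1) (nhds x) := by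
    have : Continuous (fun r : ℝ => r • x) := by fun_prop
    simpa using this.tendsto 1
  have h1 := hcont.eventually (mem_interior_iff_mem_nhds.1 hx)
  obtain ⟨ε, hε, h2⟩ := Metric.eventually_nhds_iff.1 h1
  have h3 : (1 + ε / 2) • x ∈ P := h2 (by
    rw [Real.dist_eq, add_sub_cancel_left, abs_of_pos (by positivity)]
    linarith)
  have h4 := hwp _ h3
  rw [dotp_smul_right] at h4
  nlinarith

/-- Up to affine unimodular equivalence there are only finitely many
`d`-dimensional lattice polytopes with exactly one interior lattice point; in
particular there are finitely many reflexive polytopes in each dimension. -/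
theorem stmt14 (d : ℕ) :
    (∃ S : Finset (Set (Fin d → ℝ)), ∀ P : Set (Fin d → ℝ),
        IsLatticePolytope P → fdim P = d →
        (∃! x : Fin d → ℝ, x ∈ interior P ∧ IsLatticePt x) →
        ∃ Q ∈ S, AffineLatticeEquiv P Q) ∧
    (∃ S : Finset (Set (Fin d → ℝ)), ∀ P : Set (Fin d → ℝ),
        IsReflexive P → ∃ Q ∈ S, AffineLatticeEquiv P Q) := by
  obtain ⟨S, hS⟩ := finite_one_point d
  exact ⟨⟨S, fun P hP _ hu => hS P hP hu⟩, ⟨S, fun P hP => hS P hP.1 (reflexive_unique hP)⟩⟩
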